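/- If p = ω(n^{1-s-1/d}) then with high probability H_{n,s,p} contains ω(1) pairwise vertex-disjoint d-stars, i.e. for any constant M, w.h.p. there are at least M pairwise disjoint d-stars. -/

import Mathlib

open MeasureTheory Filter Asymptotics

/-- The Bernoulli measure on `Bool` with parameter `p` (a probability measure
whenever `0 ≤ p ≤ 1`). -/
noncomputable def bern (p : ℝ) : Measure Bool :=
  ENNReal.ofReal p • Measure.dirac true + ENNReal.ofReal (1 - p) • Measure.dirac false

instance (p : ℝ) : IsFiniteMeasure (bern p) := by
  constructor
  simp only [bern, Measure.add_apply, Measure.smul_apply, smul_eq_mul,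
    measure_univ, mul_one]
  exact ENNReal.add_lt_top.mpr ⟨ENNReal.ofReal_lt_top, ENNReal.ofReal_lt_top⟩

/-- The index set of potential edges of an `s`-uniform hypergraph on `n`
vertices: the `s`-element subsets of `Fin n`. -/
abbrev EdgeIdx (n s : ℕ) := {e : Finset (Fin n) // e.card = s}

/-- A sample point of the random hypergraph `H_{n,s,p}`: for each potential edge,
whether it is present. -/
abbrev HypOmega (n s : ℕ) := EdgeIdx n s → Bool

/-- The law of `H_{n,s,p}`: each of the `C(n,s)` potential edges is present
independently with probability `p`. -/
noncomputable def hypMeasure (n s : ℕ) (p : ℝ) : Measure (HypOmega n s) :=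
  Measure.pi fun _ => bern p

/-- `(v, S)` forms a `d`-star in the hypergraph `ω`: `S` consists of `d` present
edges, all containing the centre `v`, any two of which intersect exactly in `v`. -/
def IsStar {n s : ℕ} (d : ℕ) (ω : HypOmega n s) (v : Fin n)
    (S : Finset (EdgeIdx n s)) : Prop :=
  S.card = d ∧ (∀ e ∈ S, v ∈ e.1 ∧ ω e = true) ∧
    ∀ e ∈ S, ∀ e' ∈ S, e ≠ e' → e.1 ∩ e'.1 = {v}

open scoped Classical in
/-- The number of `d`-stars in the hypergraph `ω`. -/
noncomputable def starCount (n s d : ℕ) (ω : HypOmega n s) : ℕ :=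
  (Finset.univ.filter fun vS : Fin n × Finset (EdgeIdx n s) =>
    IsStar d ω vS.1 vS.2).card

/-- The vertex support of a candidate star `(v, S)`: the centre together with all
vertices of its edges. -/
def starSupport {n s : ℕ} (vS : Fin n × Finset (EdgeIdx n s)) : Finset (Fin n) :=
  insert vS.1 (vS.2.biUnion fun e => e.1)

open ProbabilityTheory

/-! ### Product measures -/

/-- Under a product measure indexed by `ι × κ`, the rows are independent copies of the product
measure indexed by `κ`. -/
lemma measure_pi_forall_curry_mem {ι κ X : Type*} [Fintype ι] [Fintype κ] [MeasurableSpace X]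
    (ν : Measure X) [IsProbabilityMeasure ν] (A : Set (κ → X)) :
    (Measure.pi fun _ : ι × κ => ν).real {x | ∀ i, (fun k => x (i, k)) ∈ A} =
      (Measure.pi fun _ : κ => ν).real A ^ Fintype.card ι := by
  have hmap : (Measure.pi fun _ : ι × κ => ν).map (MeasurableEquiv.curry ι κ X) =
      Measure.pi fun _ : ι => Measure.pi fun _ : κ => ν := by
    have := Measure.infinitePi_map_curry (fun (_ : ι) (_ : κ) => ν)
    simpa only [Measure.infinitePi_eq_pi] using this
  have hset : {x : ι × κ → X | ∀ i, (fun k => x (i, k)) ∈ A} =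
      (MeasurableEquiv.curry ι κ X) ⁻¹' Set.pi Set.univ fun _ => A := by
    ext x
    simp only [Set.mem_ofPred_eq, Set.mem_preimage, Set.mem_pi, Set.mem_univ, true_imp_iff]
    rfl
  rw [hset, measureReal_def, ← MeasurableEquiv.map_apply, hmap, Measure.pi_pi]
  simp [measureReal_def]

/-- Restricting a sample of a product measure along an injection gives a sample of the
product measure. -/
lemma map_pi_comp_of_injective {ι κ X : Type*} [Fintype ι] [Fintype κ] [MeasurableSpace X]
    (ν : Measure X) [IsProbabilityMeasure ν] {h : κ → ι} (hh : h.Injective) :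
    (Measure.pi fun _ : ι => ν).map (fun x k => x (h k)) = Measure.pi fun _ : κ => ν := by
  have hind : iIndepFun (fun i (x : ι → X) => x i) (Measure.pi fun _ : ι => ν) :=
    iIndepFun_pi (X := fun _ => id) fun _ => aemeasurable_id
  rw [(hind.precomp hh).map_fun_eq_pi_map fun k => (measurable_pi_apply (h k)).aemeasurable]
  congr
  funext k
  exact (measurePreserving_eval (fun _ : ι => ν) (h k)).map_eq

instance isProbabilityMeasure_bern (p : Set.Icc (0 : ℝ) 1) : IsProbabilityMeasure (bern p) := by
  constructor
  simp only [bern, Measure.add_apply, Measure.smul_apply, smul_eq_mul, measure_univ, mul_one]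
  rw [← ENNReal.ofReal_add p.2.1 (sub_nonneg.2 p.2.2)]
  simp

lemma bern_real_false (p : Set.Icc (0 : ℝ) 1) : (bern p).real {false} = 1 - p := by
  simp [bern, measureReal_def, ENNReal.toReal_ofReal (sub_nonneg.2 p.2.2)]

lemma pi_bern_real_forall_false {κ : Type*} [Fintype κ] (p : Set.Icc (0 : ℝ) 1) :
    (Measure.pi fun _ : κ => bern p).real {x | ∀ k, x k = false} =
      (1 - p : ℝ) ^ Fintype.card κ := by
  have hset : {x : κ → Bool | ∀ k, x k = false} = Set.pi Set.univ fun _ => {false} := by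
    ext x
    simp [Set.mem_pi]
  rw [hset, measureReal_def, Measure.pi_pi, ← bern_real_false]
  simp [measureReal_def]

lemma pi_bern_real_exists_forall_false {β γ : Type*} [Fintype β] [Fintype γ]
    (p : Set.Icc (0 : ℝ) 1) :
    (Measure.pi fun _ : β × γ => bern p).real {x | ∃ b, ∀ c, x (b, c) = false} =
      1 - (1 - (1 - p : ℝ) ^ Fintype.card γ) ^ Fintype.card β := by
  classical
  have hset : {x : β × γ → Bool | ∃ b, ∀ c, x (b, c) = false} =
      {x | ∀ b, (fun c => x (b, c)) ∈ {y : γ → Bool | ∀ c, y c = false}ᶜ}ᶜ := by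
    ext x
    simp
  rw [hset, probReal_compl_eq_one_sub (Set.toFinite _).measurableSet,
    measure_pi_forall_curry_mem,
    probReal_compl_eq_one_sub (Set.toFinite _).measurableSet, pi_bern_real_forall_false]

lemma pi_bern_real_forall_exists_forall_false {α β γ : Type*} [Fintype α] [Fintype β]
    [Fintype γ] (p : Set.Icc (0 : ℝ) 1) :
    (Measure.pi fun _ : α × β × γ => bern p).real {x | ∀ a, ∃ b, ∀ c, x (a, b, c) = false} =
      (1 - (1 - (1 - p : ℝ) ^ Fintype.card γ) ^ Fintype.card β) ^ Fintype.card α := by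
  rw [← pi_bern_real_exists_forall_false,
    ← measure_pi_forall_curry_mem]
  rfl

/-! ### Stars with one edge into each of `d` prescribed classes -/

/-- The edge consisting of the `a`-th vertex of class `0` and the vertices indexed by `T` in
class `i + 1`, for a family `g` of `d + 1` disjoint classes of `m` vertices. -/
def classEdge {n m s d : ℕ} (g : Fin (d + 1) × Fin m ↪ Fin n)
    (k : Fin m × Fin d × {T : Finset (Fin m) // T.card = s}) : EdgeIdx n (s + 1) :=
  ⟨insert (g (0, k.1)) (k.2.2.1.map ((Function.Embedding.sectR k.2.1.succ _).trans g)), by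
    rw [Finset.card_insert_of_notMem, Finset.card_map, k.2.2.2]
    simp [g.injective.eq_iff]⟩

section classEdge

variable {n m s d : ℕ} (g : Fin (d + 1) × Fin m ↪ Fin n)

lemma mem_classEdge (k : Fin m × Fin d × {T : Finset (Fin m) // T.card = s}) (x : Fin n) :
    x ∈ (classEdge g k).1 ↔ x = g (0, k.1) ∨ ∃ b ∈ k.2.2.1, g (k.2.1.succ, b) = x := by
  simp [classEdge]

lemma apply_zero_mem_classEdge (k : Fin m × Fin d × {T : Finset (Fin m) // T.card = s})
    (a : Fin m) : g (0, a) ∈ (classEdge g k).1 ↔ a = k.1 := by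
  simp [mem_classEdge, g.injective.eq_iff]

lemma apply_succ_mem_classEdge (k : Fin m × Fin d × {T : Finset (Fin m) // T.card = s})
    (i : Fin d) (b : Fin m) :
    g (i.succ, b) ∈ (classEdge g k).1 ↔ i = k.2.1 ∧ b ∈ k.2.2.1 := by
  simp only [mem_classEdge, g.injective.eq_iff, Prod.mk.injEq, Fin.succ_ne_zero, false_and,
    false_or, Fin.succ_inj]
  grind

lemma classEdge_injective (hs : 1 ≤ s) : Function.Injective (classEdge (s := s) g) := by
  rintro ⟨a, i, T, hT⟩ ⟨a', i', T', hT'⟩ h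
  have hz := apply_zero_mem_classEdge g ⟨a, i, T, hT⟩ a
  have hsucc := fun b => apply_succ_mem_classEdge g ⟨a, i, T, hT⟩ i b
  rw [h, apply_zero_mem_classEdge] at hz
  simp only [h, apply_succ_mem_classEdge, true_and] at hsucc
  obtain rfl : a = a' := hz.2 rfl
  obtain ⟨b, hb⟩ : T.Nonempty := Finset.card_pos.1 (by omega)
  obtain rfl : i = i' := ((hsucc b).2 hb).1
  obtain rfl : T = T' := by
    ext c
    simpa using (hsucc c).symm
  rfl

lemma classEdge_inter (a : Fin m) {i j : Fin d} (hij : i ≠ j)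
    (T U : {T : Finset (Fin m) // T.card = s}) :
    (classEdge g (a, i, T)).1 ∩ (classEdge g (a, j, U)).1 = {g (0, a)} := by
  ext x
  simp only [Finset.mem_inter, Finset.mem_singleton]
  constructor
  · rintro ⟨hx, hx'⟩
    rcases (mem_classEdge g _ x).1 hx with h | ⟨b, -, rfl⟩
    · exact h
    · exact absurd ((apply_succ_mem_classEdge g _ i b).1 hx').1 hij
  · rintro rfl
    simp [apply_zero_mem_classEdge]

lemma exists_isStar_of_classEdge (hs : 1 ≤ s) (ω : HypOmega n (s + 1)) (a : Fin m)
    (h : ∀ i : Fin d, ∃ T : {T : Finset (Fin m) // T.card = s},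
      ω (classEdge g (a, i, T)) = true) :
    ∃ vS : Fin n × Finset (EdgeIdx n (s + 1)), IsStar d ω vS.1 vS.2 ∧
      ∀ x ∈ starSupport vS, x ∈ Set.range g := by
  classical
  choose T hT using h
  refine ⟨(g (0, a), Finset.univ.image fun i => classEdge g (a, i, T i)), ⟨?_, ?_, ?_⟩, ?_⟩
  · rw [Finset.card_image_of_injective, Finset.card_univ, Fintype.card_fin]
    intro i j hij
    have := classEdge_injective g hs hij
    simp only [Prod.mk.injEq] at this
    exact this.2.1
  · intro e he
    obtain ⟨i, -, rfl⟩ := Finset.mem_image.1 he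
    exact ⟨(apply_zero_mem_classEdge g _ a).2 rfl, hT i⟩
  · intro e he e' he' hne
    obtain ⟨i, -, rfl⟩ := Finset.mem_image.1 he
    obtain ⟨j, -, rfl⟩ := Finset.mem_image.1 he'
    exact classEdge_inter g a (fun hij => hne (by rw [hij])) _ _
  · intro x hx
    simp only [starSupport, Finset.mem_insert, Finset.mem_biUnion, Finset.mem_image,
      Finset.mem_univ, true_and] at hx
    rcases hx with rfl | ⟨_, ⟨i, rfl⟩, hx⟩
    · exact ⟨_, rfl⟩
    · rcases (mem_classEdge g _ x).1 hx with rfl | ⟨b, -, rfl⟩ <;> exact ⟨_, rfl⟩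

/-- The probability that no vertex of class `0` is the centre of a star with one edge into each
of the other classes. -/
lemma hypMeasure_real_forall_exists_classEdge_false (hs : 1 ≤ s) (p : Set.Icc (0 : ℝ) 1) :
    (hypMeasure n (s + 1) p).real {ω | ∀ a, ∃ i, ∀ T, ω (classEdge g (a, i, T)) = false} =
      (1 - (1 - (1 - p : ℝ) ^ m.choose s) ^ d) ^ m := by
  have h := pi_bern_real_forall_exists_forall_false (α := Fin m) (β := Fin d)
    (γ := {T : Finset (Fin m) // T.card = s}) p
  rw [← map_pi_comp_of_injective _ (classEdge_injective (s := s) g hs),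
    map_measureReal_apply (measurable_pi_lambda _ fun k => measurable_pi_apply _)
      (Set.toFinite _).measurableSet] at h
  simpa [hypMeasure] using h

end classEdge

/-- The failure probability of `M` disjoint stars, from a union bound over `M` disjoint vertex
blocks. -/
lemma one_sub_le_hypMeasure_real_disjoint_stars {n m s d M : ℕ} (hs : 1 ≤ s)
    (p : Set.Icc (0 : ℝ) 1) (hn : M * ((d + 1) * m) ≤ n) :
    1 - M * (1 - (1 - (1 - p : ℝ) ^ m.choose s) ^ d) ^ m ≤
      (hypMeasure n (s + 1) p).real
        {ω | ∃ f : Fin M → Fin n × Finset (EdgeIdx n (s + 1)),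
          (∀ i, IsStar d ω (f i).1 (f i).2) ∧
          ∀ i j, i ≠ j → Disjoint (starSupport (f i)) (starSupport (f j))} := by
  obtain ⟨G⟩ : Nonempty (Fin M × Fin (d + 1) × Fin m ↪ Fin n) :=
    Function.Embedding.nonempty_of_card_le (by simpa using hn)
  let g (j : Fin M) : Fin (d + 1) × Fin m ↪ Fin n := (Function.Embedding.sectR j _).trans G
  have : IsProbabilityMeasure (hypMeasure n (s + 1) p) := by
    unfold hypMeasure
    infer_instance
  set good := {ω : HypOmega n (s + 1) | ∃ f : Fin M → Fin n × Finset (EdgeIdx n (s + 1)),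
    (∀ i, IsStar d ω (f i).1 (f i).2) ∧
    ∀ i j, i ≠ j → Disjoint (starSupport (f i)) (starSupport (f j))}
  have hsub : goodᶜ ⊆
      ⋃ j, {ω | ∀ a, ∃ i, ∀ T, ω (classEdge (g j) (a, i, T)) = false} := by
    rw [Set.compl_subset_comm]
    intro ω hω
    simp only [Set.mem_compl_iff, Set.mem_iUnion, Set.mem_ofPred_eq, not_exists, not_forall,
      Bool.not_eq_false] at hω
    choose a ha using hω
    choose f hf hsupp using fun j => exists_isStar_of_classEdge (g j) hs ω (a j) (ha j)
    refine ⟨f, hf, fun i j hij => Finset.disjoint_left.2 fun x hx hx' => hij ?_⟩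
    obtain ⟨y, rfl⟩ := hsupp i x hx
    obtain ⟨z, hz⟩ := hsupp j _ hx'
    exact (Prod.mk.inj (G.injective hz)).1.symm
  have hbound := (measureReal_mono (μ := hypMeasure n (s + 1) p) hsub).trans
    (measureReal_iUnion_fintype_le _)
  simp only [hypMeasure_real_forall_exists_classEdge_false _ hs, Finset.sum_const,
    Finset.card_univ, Fintype.card_fin, nsmul_eq_mul] at hbound
  rw [probReal_compl_eq_one_sub (Set.toFinite _).measurableSet] at hbound
  linarith

/-! ### Asymptotics -/

lemma Real.min_half_le_one_sub_exp_neg {x : ℝ} (hx : 0 ≤ x) :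
    min (1 / 2) (x / 2) ≤ 1 - Real.exp (-x) := by
  have h : Real.exp (-x) ≤ 1 / (1 + x) := by
    rw [Real.exp_neg, ← one_div]
    exact one_div_le_one_div_of_le (by linarith) (by linarith [Real.add_one_le_exp x])
  have h' : 1 - 1 / (1 + x) = x / (1 + x) := by
    field_simp
    ring
  refine le_trans ?_ (sub_le_sub_left h 1)
  rw [h']
  rcases le_total x 1 with h1 | h1
  · exact (min_le_right _ _).trans (div_le_div_of_nonneg_left hx (by linarith) (by linarith))
  · refine (min_le_left _ _).trans ?_
    rw [div_le_div_iff₀ (by norm_num) (by linarith)]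
    linarith

lemma one_sub_pow_pow_le_exp (p : Set.Icc (0 : ℝ) 1) (N d m : ℕ) :
    (1 - (1 - (1 - p : ℝ) ^ N) ^ d) ^ m ≤
      Real.exp (-min (m * (1 / 2 : ℝ) ^ d) (m * (N * p / 2 : ℝ) ^ d)) := by
  obtain ⟨p, hp0, hp1⟩ := p
  have hpow0 : 0 ≤ (1 - p) ^ N := pow_nonneg (by linarith) N
  have hpow1 : (1 - p) ^ N ≤ 1 := pow_le_one₀ (by linarith) (by linarith)
  have hexp : (1 - p) ^ N ≤ Real.exp (-(N * p)) := by
    refine (pow_le_pow_left₀ (by linarith) (Real.one_sub_le_exp_neg p) N).trans_eq ?_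
    rw [← Real.exp_nat_mul]
    ring_nf
  have hmin : min (1 / 2) (N * p / 2) ≤ 1 - (1 - p) ^ N :=
    (Real.min_half_le_one_sub_exp_neg (by positivity)).trans (by linarith)
  have hd : min ((1 / 2 : ℝ) ^ d) ((N * p / 2) ^ d) ≤ (1 - (1 - p) ^ N) ^ d := by
    refine le_trans ?_ (pow_le_pow_left₀ (by positivity) hmin d)
    rcases min_choice (1 / 2 : ℝ) (N * p / 2) with h | h <;> rw [h] <;> simp
  have hle : (1 - (1 - p) ^ N) ^ d ≤ 1 := pow_le_one₀ (by linarith) (by linarith)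
  refine (pow_le_pow_left₀ (by linarith) (Real.one_sub_le_exp_neg _) m).trans ?_
  rw [← Real.exp_nat_mul, Real.exp_le_exp, mul_neg, neg_le_neg_iff,
    ← mul_min_of_nonneg _ _ (Nat.cast_nonneg m)]
  gcongr

lemma eventually_mul_le_nat_div {K : ℕ} (hK : 0 < K) :
    ∀ᶠ n : ℕ in atTop, (1 / (2 * K) : ℝ) * n ≤ (n / K : ℕ) := by
  filter_upwards [eventually_ge_atTop K] with n hn
  have h1 : 1 ≤ n / K := (Nat.one_le_div_iff hK).2 hn
  have h2 : n ≤ 2 * K * (n / K) := by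
    have := Nat.div_add_mod n K
    have := Nat.mod_lt n hK
    nlinarith
  have h3 : (n : ℝ) ≤ 2 * K * (n / K : ℕ) := by exact_mod_cast h2
  rw [one_div_mul_eq_div, div_le_iff₀ (by positivity)]
  linarith

lemma eventually_mul_pow_le_choose (r : ℕ) :
    ∀ᶠ m : ℕ in atTop, (1 / (2 ^ r * r.factorial) : ℝ) * (m : ℝ) ^ r ≤ m.choose r := by
  filter_upwards [eventually_ge_atTop (2 * r)] with m hm
  refine le_trans ?_ (Nat.pow_le_choose (α := ℝ) r m)
  have h : (m : ℝ) / 2 ≤ (m + 1 - r : ℕ) := by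
    have : (m : ℝ) ≤ 2 * (m + 1 - r : ℕ) := by
      exact_mod_cast (show m ≤ 2 * (m + 1 - r) by omega)
    linarith
  calc (1 / (2 ^ r * r.factorial) : ℝ) * (m : ℝ) ^ r = (m / 2) ^ r / r.factorial := by
        rw [div_pow]
        field_simp
    _ ≤ _ := by gcongr

lemma tendsto_nat_div_atTop {K : ℕ} (hK : 0 < K) :
    Tendsto (fun n : ℕ => n / K) atTop atTop :=
  tendsto_atTop.2 fun b => (eventually_ge_atTop (b * K)).mono fun _ hn =>
    (Nat.le_div_iff_mul_le hK).2 hn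

lemma tendsto_div_rpow_atTop_of_isLittleO {p : ℕ → ℝ} {t : ℝ} (hp : ∀ n, 0 ≤ p n)
    (hlo : (fun n : ℕ => (n : ℝ) ^ t) =o[atTop] p) :
    Tendsto (fun n : ℕ => p n / (n : ℝ) ^ t) atTop atTop := by
  refine tendsto_atTop.2 fun b => ?_
  filter_upwards [hlo.def (show (0 : ℝ) < 1 / (|b| + 1) by positivity),
    eventually_gt_atTop 0] with n hn hn0
  have hpos : (0 : ℝ) < (n : ℝ) ^ t := Real.rpow_pos_of_pos (by exact_mod_cast hn0) t
  rw [Real.norm_of_nonneg hpos.le, Real.norm_of_nonneg (hp n), one_div_mul_eq_div,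
    le_div_iff₀ (by positivity)] at hn
  rw [le_div_iff₀ hpos]
  nlinarith [le_abs_self b]

/-- The expected number of stars, up to constants, in blocks of linear size. -/
lemma tendsto_mul_choose_mul_pow_atTop {r d K : ℕ} (hd : 1 ≤ d) (hK : 0 < K) {p : ℕ → ℝ}
    (hp : ∀ n, 0 ≤ p n)
    (hlo : (fun n : ℕ => (n : ℝ) ^ (-(r : ℝ) - 1 / (d : ℝ))) =o[atTop] p) :
    Tendsto (fun n : ℕ => ((n / K : ℕ) : ℝ) * ((n / K).choose r * p n / 2) ^ d)
      atTop atTop := by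
  set c : ℝ := 1 / (2 * K) with hc
  set c' : ℝ := 1 / (2 ^ r * r.factorial) with hc'
  have hcpos : 0 < c := by positivity
  have hcpos' : 0 < c' := by positivity
  have hlim : Tendsto (fun n : ℕ => c * (c' * c ^ r / 2) ^ d *
      (p n / (n : ℝ) ^ (-(r : ℝ) - 1 / (d : ℝ))) ^ d) atTop atTop :=
    ((tendsto_pow_atTop (by omega)).comp
      (tendsto_div_rpow_atTop_of_isLittleO hp hlo)).const_mul_atTop (by positivity)
  refine tendsto_atTop_mono' _ ?_ hlim
  filter_upwards [eventually_mul_le_nat_div hK,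
    (tendsto_nat_div_atTop hK).eventually (eventually_mul_pow_le_choose r),
    eventually_gt_atTop 0] with n hm hN hn
  have hnpos : (0 : ℝ) < n := by exact_mod_cast hn
  have hrpow : ((n : ℝ) ^ (-(r : ℝ) - 1 / (d : ℝ))) ^ d = ((n : ℝ) ^ (r * d) * n)⁻¹ := by
    have hd0 : (d : ℝ) ≠ 0 := by positivity
    rw [← Real.rpow_natCast, ← Real.rpow_mul hnpos.le, ← pow_succ, ← Real.rpow_natCast,
      ← Real.rpow_neg hnpos.le]
    congr 1
    push_cast
    field_simp
    ring
  calc c * (c' * c ^ r / 2) ^ d * (p n / (n : ℝ) ^ (-(r : ℝ) - 1 / (d : ℝ))) ^ d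
      = (c * n) * (c' * (c * n) ^ r * p n / 2) ^ d := by
        rw [div_pow (p n), hrpow, div_inv_eq_mul, pow_mul]
        simp only [mul_pow, div_pow]
        ring
    _ ≤ ((n / K : ℕ) : ℝ) * ((n / K).choose r * p n / 2) ^ d := by
        have := hp n
        gcongr
        exact le_trans (by gcongr) hN

/-- If `p = ω(n^{1-s-1/d})`, then w.h.p. `H_{n,s,p}` contains `ω(1)` pairwise
vertex-disjoint `d`-stars: for every constant `M`, w.h.p. there are at least `M`
pairwise vertex-disjoint `d`-stars. -/
theorem stmt13 (s d : ℕ) (hs : 2 ≤ s) (hd : 1 ≤ d)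
    (p : ℕ → ℝ) (hp : ∀ n, 0 ≤ p n ∧ p n ≤ 1)
    (hlo : (fun n : ℕ => (n : ℝ) ^ ((1 : ℝ) - (s : ℝ) - 1 / (d : ℝ)))
      =o[Filter.atTop] p) :
    ∀ M : ℕ, Filter.Tendsto
      (fun n => hypMeasure n s (p n)
        {ω | ∃ f : Fin M → Fin n × Finset (EdgeIdx n s),
          (∀ i, IsStar d ω (f i).1 (f i).2) ∧
          ∀ i j, i ≠ j → Disjoint (starSupport (f i)) (starSupport (f j))})
      Filter.atTop (nhds 1) := by
  intro M
  obtain ⟨r, rfl⟩ : ∃ r, s = r + 1 := ⟨s - 1, by omega⟩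
  have hexponent : (1 : ℝ) - ((r + 1 : ℕ) : ℝ) - 1 / d = -(r : ℝ) - 1 / d := by
    push_cast
    ring
  rw [hexponent] at hlo
  set K := (M + 1) * (d + 1) with hKdef
  have hK : 0 < K := by positivity
  have hfail : Tendsto (fun n : ℕ =>
      (1 - (1 - (1 - p n) ^ (n / K).choose r) ^ d) ^ (n / K)) atTop (nhds 0) := by
    refine squeeze_zero (fun n => ?_)
      (fun n => one_sub_pow_pow_le_exp ⟨p n, hp n⟩ ((n / K).choose r) d (n / K)) ?_
    · have hpow0 : 0 ≤ (1 - p n) ^ (n / K).choose r := pow_nonneg (by linarith [hp n]) _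
      have hpow1 : (1 - p n) ^ (n / K).choose r ≤ 1 :=
        pow_le_one₀ (by linarith [hp n]) (by linarith [hp n])
      exact pow_nonneg (sub_nonneg.2 (pow_le_one₀ (by linarith) (by linarith))) _
    · refine Real.tendsto_exp_neg_atTop_nhds_zero.comp (tendsto_atTop.2 fun b => ?_)
      have hlin : Tendsto (fun n : ℕ => ((n / K : ℕ) : ℝ) * (1 / 2) ^ d) atTop atTop :=
        (tendsto_natCast_atTop_atTop.comp (tendsto_nat_div_atTop hK)).atTop_mul_const
          (by positivity)
      filter_upwards [hlin.eventually_ge_atTop b,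
        (tendsto_mul_choose_mul_pow_atTop hd hK (fun n => (hp n).1) hlo).eventually_ge_atTop b]
        with n h1 h2 using le_min h1 h2
  have hprob (n : ℕ) : IsProbabilityMeasure (hypMeasure n (r + 1) (p n)) := by
    have := isProbabilityMeasure_bern ⟨p n, hp n⟩
    unfold hypMeasure
    infer_instance
  rw [← ENNReal.tendsto_toReal_iff (fun n => measure_ne_top _ _) ENNReal.one_ne_top,
    ENNReal.toReal_one]
  refine tendsto_of_tendsto_of_tendsto_of_le_of_le
    (by simpa using (hfail.const_mul (M : ℝ)).const_sub 1) tendsto_const_nhds (fun n => ?_)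
    fun n => measureReal_le_one
  refine one_sub_le_hypMeasure_real_disjoint_stars (by omega) ⟨p n, hp n⟩ ?_
  calc M * ((d + 1) * (n / K)) ≤ K * (n / K) := by
        rw [hKdef, ← mul_assoc]
        gcongr
        omega
    _ ≤ n := Nat.mul_div_le n K
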